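/- Let X be a nonempty finite set, let # be a symbol not in X, and write X# = X ∪ {#}. Then the one-sided Dyck language D'_X over X̄ is a rational transduction of the two-sided Dyck language D_{X#} over (X#)̄, i.e., of the word problem of the free group F(X#). -/

import Mathlib

/-- `K ⊆ B*` is a rational transduction of `L ⊆ A*` (Nivat's characterization):
there are a finite alphabet `Z`, a regular language `R ⊆ Z*` and monoid
homomorphisms `α : Z* → A*`, `β : Z* → B*` with `K = β(α⁻¹(L) ∩ R)`. -/
def IsRatTransOf {A B : Type*} (L : Set (FreeMonoid A)) (K : Set (FreeMonoid B)) : Prop :=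
  ∃ (Z : Type) (_ : Fintype Z) (R : Language Z)
    (α : FreeMonoid Z →* FreeMonoid A) (β : FreeMonoid Z →* FreeMonoid B),
    R.IsRegular ∧ K = β '' (α ⁻¹' L ∩ (R : Set (FreeMonoid Z)))

/-- The one-sided (semi-)Dyck language over the alphabet `X × Bool`
(`(x, true)` is the positive letter `x`, `(x, false)` is `x⁻¹`): the smallest
language containing the empty word, closed under concatenation, and containing
`x·u·x⁻¹` whenever it contains `u`.  It is the identity language of the
polycyclic monoid on `X`. -/
inductive IsSemiDyck {X : Type*} : List (X × Bool) → Prop where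
  | nil : IsSemiDyck []
  | append {u v : List (X × Bool)} : IsSemiDyck u → IsSemiDyck v → IsSemiDyck (u ++ v)
  | wrap {u : List (X × Bool)} (x : X) :
      IsSemiDyck u → IsSemiDyck ((x, true) :: (u ++ [(x, false)]))

/-- Permitted adjacencies: a negative letter is followed by a positive one only in `x⁻¹ #`. -/
def dyckAdj {X : Type} (a b : (X ⊕ Unit) × Bool) : Prop :=
  a.2 = true ∨ b.2 = false ∨ (a.1.isLeft = true ∧ b.1.isRight = true)

/-- Erasing `#` on letters. -/
def eraseLetter {X : Type} : (X ⊕ Unit) × Bool → List (X × Bool)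
  | (Sum.inl x, b) => [(x, b)]
  | (Sum.inr _, _) => []

/-- Words with only permitted adjacencies. -/
def chainLang (X : Type) : Language ((X ⊕ Unit) × Bool) := {w | List.IsChain dyckAdj w}

theorem chainLang_regular (X : Type) [Fintype X] : (chainLang X).IsRegular := by
  classical
  rw [Language.isRegular_iff_finite_range_leftQuotient]
  let g : Option ((X ⊕ Unit) × Bool) × Prop → Language ((X ⊕ Unit) × Bool) :=
    fun p => {y | p.2 ∧ List.IsChain dyckAdj y ∧ ∀ a ∈ p.1, ∀ b ∈ y.head?, dyckAdj a b}
  refine (Set.finite_range g).subset ?_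
  rintro _ ⟨w, rfl⟩
  refine ⟨(w.getLast?, List.IsChain dyckAdj w), ?_⟩
  ext y
  change (_ ∧ _ ∧ _) ↔ List.IsChain dyckAdj (w ++ y)
  rw [List.isChain_append]

theorem IsSemiDyck.insert {X : Type} {w : List (X × Bool)} (h : IsSemiDyck w) (x : X) :
    ∀ u v, w = u ++ v → IsSemiDyck (u ++ (x, true) :: (x, false) :: v) := by
  have base : IsSemiDyck [(x, true), (x, false)] := IsSemiDyck.wrap x IsSemiDyck.nil
  induction h with
  | nil =>
    intro u v h
    obtain ⟨rfl, rfl⟩ := List.append_eq_nil_iff.1 h.symm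
    exact base
  | @append p q hp hq ihp ihq =>
    intro u v h
    rcases List.append_eq_append_iff.1 h with ⟨c, rfl, rfl⟩ | ⟨c, rfl, rfl⟩
    · have := IsSemiDyck.append hp (ihq c v rfl)
      simpa using this
    · have := IsSemiDyck.append (ihp u c rfl) hq
      simpa using this
  | @wrap p y hp ih =>
    intro u v h
    rcases u with _ | ⟨a, u⟩
    · simp only [List.nil_append] at h
      subst h
      have := IsSemiDyck.append base (IsSemiDyck.wrap y hp)
      simpa using this
    · simp only [List.cons_append, List.cons.injEq] at h
      obtain ⟨rfl, h⟩ := h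
      rcases List.eq_nil_or_concat v with rfl | ⟨v', b, rfl⟩
      · simp only [List.append_nil] at h
        subst h
        have := IsSemiDyck.append (IsSemiDyck.wrap y hp) base
        simpa using this
      · rw [List.concat_eq_append, ← List.append_assoc] at h
        obtain ⟨h1, h2⟩ := List.append_inj' h rfl
        simp only [List.cons.injEq, and_true] at h2
        subst h2
        have := IsSemiDyck.wrap y (ih u v' h1)
        simpa using this

theorem isSemiDyck_of_red {X : Type} {w : List ((X ⊕ Unit) × Bool)}
    (h : FreeGroup.Red w []) : List.IsChain dyckAdj w → IsSemiDyck (w.flatMap eraseLetter) := by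
  induction h using Relation.ReflTransGen.head_induction_on with
  | refl => intro _; exact IsSemiDyck.nil
  | head hs _ ih =>
    intro hc
    rcases hs with @⟨L1, L2, a, b⟩
    rw [List.isChain_append, List.isChain_cons, List.isChain_cons] at hc
    obtain ⟨h1, ⟨hab, hb2, h2⟩, h3⟩ := hc
    have hb : b = true := by
      have := hab _ rfl
      cases b
      · rcases a with a | a <;> simp [dyckAdj] at this
      · rfl
    subst hb
    have hc' : List.IsChain dyckAdj (L1 ++ L2) := by
      rw [List.isChain_append]
      refine ⟨h1, h2, ?_⟩
      intro p hp q hq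
      have e1 := h3 p hp _ rfl
      have e2 := hb2 q hq
      rcases a with a | a <;> simp [dyckAdj] at e1 e2 ⊢ <;> tauto
    have := ih hc'
    rw [List.flatMap_append] at this
    rcases a with a | a
    · have := this.insert a _ _ rfl
      simpa [List.flatMap_append, eraseLetter] using this
    · simpa [List.flatMap_append, eraseLetter] using this

theorem exists_of_semiDyck {X : Type} {w : List (X × Bool)} (h : IsSemiDyck w) :
    ∃ (z : List ((X ⊕ Unit) × Bool)) (n : ℕ), List.IsChain dyckAdj z ∧
      z.flatMap eraseLetter = w ∧ FreeGroup.mk z = FreeGroup.of (Sum.inr ()) ^ n ∧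
      (∀ a ∈ z.head?, a = (Sum.inr (), true)) ∧
      (∀ a ∈ z.getLast?, a.1.isLeft = true ∧ a.2 = false) := by
  induction h with
  | nil => exact ⟨[], 0, by simp [← FreeGroup.one_eq_mk]⟩
  | append _ _ ih1 ih2 =>
    obtain ⟨z1, n1, c1, f1, m1, s1, e1⟩ := ih1
    obtain ⟨z2, n2, c2, f2, m2, s2, e2⟩ := ih2
    refine ⟨z1 ++ z2, n1 + n2, ?_, ?_, ?_, ?_, ?_⟩
    · rw [List.isChain_append]
      refine ⟨c1, c2, fun a ha b hb => ?_⟩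
      have := s2 b hb
      subst this
      exact Or.inr (Or.inr ⟨(e1 a ha).1, rfl⟩)
    · rw [List.flatMap_append, f1, f2]
    · rw [← FreeGroup.mul_mk, m1, m2, pow_add]
    · intro a ha
      rcases z1 with _ | ⟨b, z1⟩
      · exact s2 a ha
      · exact s1 a ha
    · intro a ha
      rcases List.eq_nil_or_concat z2 with rfl | ⟨z2, b, rfl⟩
      · exact e1 a (by simpa using ha)
      · exact e2 a (by simpa [List.getLast?_append] using ha)
  | wrap x _ ih =>
    obtain ⟨z, n, c, f, m, s, e⟩ := ih
    refine ⟨(Sum.inr (), true) :: (Sum.inl x, true) ::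
      (z ++ (List.replicate n (Sum.inr (), false) ++ [(Sum.inl x, false)])), 1, ?_, ?_, ?_, ?_, ?_⟩
    · rw [List.isChain_cons, List.isChain_cons, List.isChain_append, List.isChain_append]
      refine ⟨fun _ _ => Or.inl rfl, fun _ _ => Or.inl rfl, c, ⟨?_, ?_, ?_⟩, ?_⟩
      · exact List.isChain_replicate_of_rel n (Or.inr (Or.inl rfl))
      · simp
      · intro a _ b hb
        simp at hb
        subst hb
        exact Or.inr (Or.inl rfl)
      · intro a _ b hb
        refine Or.inr (Or.inl ?_)
        cases n <;> simp [List.replicate_succ] at hb <;> subst hb <;> rfl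
    · have : (List.replicate n ((Sum.inr (), false) : (X ⊕ Unit) × Bool)).flatMap eraseLetter
          = [] := by
        simp [List.flatMap_eq_nil_iff, eraseLetter]
      simp [List.flatMap_append, f, this, eraseLetter]
    · have hr : FreeGroup.mk (List.replicate n ((Sum.inr (), false) : (X ⊕ Unit) × Bool))
          = (FreeGroup.of (Sum.inr ()) ^ n)⁻¹ := by
        clear m
        induction n with
        | zero => simp [← FreeGroup.one_eq_mk]
        | succ n ih =>
          rw [List.replicate_succ', ← FreeGroup.mul_mk, ih, pow_succ', mul_inv_rev]
          rfl
      have e : ∀ l, FreeGroup.mk ((Sum.inr (), true) :: (Sum.inl x, true) :: l) =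
          FreeGroup.of (Sum.inr ()) * FreeGroup.of (Sum.inl x) * FreeGroup.mk l := fun l => rfl
      have e' : FreeGroup.mk [((Sum.inl x, false) : (X ⊕ Unit) × Bool)]
        = (FreeGroup.of (Sum.inl x))⁻¹ := rfl
      rw [e, ← FreeGroup.mul_mk, ← FreeGroup.mul_mk, m, hr, e']
      group
    · simp
    · intro a ha
      have : a = (Sum.inl x, false) := by
        rw [← List.append_assoc, ← List.cons_append, ← List.cons_append,
          List.getLast?_append] at ha
        simpa using ha.symm
      subst this
      exact ⟨rfl, rfl⟩

theorem exists_closed_of_semiDyck {X : Type} {w : List (X × Bool)} (h : IsSemiDyck w) :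
    ∃ z : List ((X ⊕ Unit) × Bool), List.IsChain dyckAdj z ∧
      z.flatMap eraseLetter = w ∧ FreeGroup.mk z = 1 := by
  obtain ⟨z, n, c, f, m, -, -⟩ := exists_of_semiDyck h
  refine ⟨z ++ List.replicate n (Sum.inr (), false), ?_, ?_, ?_⟩
  · rw [List.isChain_append]
    refine ⟨c, List.isChain_replicate_of_rel n (Or.inr (Or.inl rfl)), ?_⟩
    intro a _ b hb
    refine Or.inr (Or.inl ?_)
    cases n <;> simp [List.replicate_succ] at hb
    subst hb; rfl
  · simp [List.flatMap_append, f, List.flatMap_eq_nil_iff, eraseLetter]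
  · have hr : FreeGroup.mk (List.replicate n ((Sum.inr (), false) : (X ⊕ Unit) × Bool))
        = (FreeGroup.of (Sum.inr ()) ^ n)⁻¹ := by
      clear m
      induction n with
      | zero => simp [← FreeGroup.one_eq_mk]
      | succ n ih =>
        rw [List.replicate_succ', ← FreeGroup.mul_mk, ih, pow_succ', mul_inv_rev]
        rfl
    rw [← FreeGroup.mul_mk, m, hr, mul_inv_cancel]

/-- For a nonempty finite set `X`, the one-sided Dyck language over `X` is a
rational transduction of the two-sided Dyck language over `X# = X ⊕ Unit`, i.e.
of the word problem of the free group `F(X#)`. -/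
theorem semiDyck_ratTrans_twoSidedDyck
    {X : Type} [Fintype X] [Nonempty X] :
    IsRatTransOf
      {w : FreeMonoid ((X ⊕ Unit) × Bool) | FreeGroup.mk (FreeMonoid.toList w) = 1}
      {w : FreeMonoid (X × Bool) | IsSemiDyck (FreeMonoid.toList w)} := by
  have hβ : ∀ l : List ((X ⊕ Unit) × Bool),
      FreeMonoid.lift (fun z => FreeMonoid.ofList (eraseLetter z)) (FreeMonoid.ofList l)
        = FreeMonoid.ofList (l.flatMap eraseLetter) := by
    intro l
    induction l with
    | nil => rfl
    | cons a l ih =>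
      rw [FreeMonoid.ofList_cons, map_mul, ih, FreeMonoid.lift_eval_of, List.flatMap_cons,
        FreeMonoid.ofList_append]
  refine ⟨(X ⊕ Unit) × Bool, inferInstance, chainLang X, MonoidHom.id _,
    FreeMonoid.lift (fun z => FreeMonoid.ofList (eraseLetter z)), chainLang_regular X, ?_⟩
  ext w
  constructor
  · intro h
    obtain ⟨z, c, f, m⟩ := exists_closed_of_semiDyck h
    exact ⟨FreeMonoid.ofList z, ⟨m, c⟩, (hβ z).trans (by rw [f]; rfl)⟩
  · rintro ⟨z, ⟨m, c⟩, rfl⟩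
    have hred : FreeGroup.Red (FreeMonoid.toList z) [] := by
      have m' : FreeGroup.mk (FreeMonoid.toList z) = FreeGroup.mk [] := m
      obtain ⟨y, h1, h2⟩ := FreeGroup.Red.exact.1 m'
      rw [FreeGroup.Red.nil_iff] at h2
      exact h2 ▸ h1
    have := isSemiDyck_of_red hred c
    have e := hβ (FreeMonoid.toList z)
    rw [FreeMonoid.ofList_toList] at e
    change IsSemiDyck (FreeMonoid.toList _)
    rw [e]
    exact this
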